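/- Assume Hypotheses (H_C) and (H_G), let S ⊆ ℝⁿ be closed, and suppose the minimum time function T is lower semicontinuous on graph(C) and not identically +∞. Then the epigraph of T is weakly invariant for the augmented dynamics Γ(τ,x,λ) = {1} × (−N_{C(τ)}(x) + G(τ,x)) × {−1}; precisely: for every (t₀,x₀) ∈ graph(C) with T(t₀,x₀) < ∞ and every real λ₀ ≥ T(t₀,x₀), there exists a solution x of the perturbed sweeping process on [t₀, t₀ + T(t₀,x₀)] with x(t₀) = x₀ such that T(t₀ + s, x(t₀ + s)) ≤ λ₀ − s for all s ∈ [0, T(t₀,x₀)]. -/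

import Mathlib

open scoped Pointwise RealInnerProductSpace ENNReal
open Set Metric MeasureTheory

variable {E : Type*} [NormedAddCommGroup E] [InnerProductSpace ℝ E]

/-- Proximal normal cone to `K` at `x` (empty when `x ∉ K`):
`v ∈ N_K(x)` iff `x ∈ K` and there is `σ ≥ 0` with `⟪v, y - x⟫ ≤ σ‖y - x‖²` for all `y ∈ K`. -/
def proxNormalCone (K : Set E) (x : E) : Set E :=
  {v | x ∈ K ∧ ∃ σ : ℝ, 0 ≤ σ ∧ ∀ y ∈ K, ⟪v, y - x⟫ ≤ σ * ‖y - x‖ ^ 2}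

/-- `r`-prox-regularity of a closed set. -/
def ProxRegular (r : ℝ) (C : Set E) : Prop :=
  ∀ x ∈ C, ∀ y ∈ C, ∀ ζ ∈ proxNormalCone C x,
    ⟪ζ, y - x⟫ ≤ 1 / (2 * r) * ‖ζ‖ * ‖y - x‖ ^ 2

/-- Hypothesis (H_C): values are nonempty, compact, `r`-prox-regular; `L_C`-Lipschitz
for the Hausdorff distance. -/
structure HypC (r L_C : ℝ) (C : ℝ → Set E) : Prop where
  nonempty : ∀ t, 0 ≤ t → (C t).Nonempty
  isCompact : ∀ t, 0 ≤ t → IsCompact (C t)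
  proxRegular : ∀ t, 0 ≤ t → ProxRegular r (C t)
  lipschitz : ∀ s t, 0 ≤ s → 0 ≤ t → hausdorffDist (C s) (C t) ≤ L_C * |s - t|

/-- Hypothesis (H_G): nonempty, closed, convex values, bounded by `M`, `L_G`-Lipschitz
for the Hausdorff distance. -/
structure HypG (M L_G : ℝ) (G : ℝ → E → Set E) : Prop where
  nonempty : ∀ t x, (G t x).Nonempty
  isClosed : ∀ t x, IsClosed (G t x)
  convex : ∀ t x, Convex ℝ (G t x)
  bounded : ∀ t x, ∀ v ∈ G t x, ‖v‖ ≤ M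
  lipschitz : ∀ s t (x y : E), hausdorffDist (G s x) (G t y) ≤ L_G * (|s - t| + ‖x - y‖)

/-- Solution of the perturbed sweeping process `ẋ(t) ∈ -N_{C(t)}(x(t)) + G(t, x(t))`
on `[t0, T]`: an (absolutely continuous) integral of an integrable derivative `x'`
satisfying the differential inclusion a.e., with `x(t) ∈ C(t)` for all `t ∈ [t0, T]`. -/
def IsSweepingSol (C : ℝ → Set E) (G : ℝ → E → Set E) (t0 T : ℝ) (x : ℝ → E) : Prop :=
  (∀ t ∈ Icc t0 T, x t ∈ C t) ∧
  ∃ x' : ℝ → E, IntegrableOn x' (Icc t0 T) ∧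
    (∀ t ∈ Icc t0 T, x t = x t0 + ∫ s in t0..t, x' s) ∧
    ∀ᵐ t ∂(volume.restrict (Icc t0 T)),
      x' t ∈ -proxNormalCone (C t) (x t) + G t (x t)

/-- Minimum time to reach the target `S` subject to the perturbed sweeping process,
starting at `x0 ∈ C t0` at time `t0` (`+∞` if `S` is never reached). -/
noncomputable def minTime (C : ℝ → Set E) (G : ℝ → E → Set E) (S : Set E)
    (t0 : ℝ) (x0 : E) : ℝ≥0∞ :=
  sInf (ENNReal.ofReal '' {a : ℝ | 0 ≤ a ∧ ∃ x : ℝ → E,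
    IsSweepingSol C G t0 (t0 + a) x ∧ x t0 = x0 ∧ x (t0 + a) ∈ S})

/-- Proximal normal cone in the product space `ℝ × E` (with the Euclidean product
inner product `⟪(a,v),(b,w)⟫ = a*b + ⟪v,w⟫`). -/
def proxNormalCone2 (K : Set (ℝ × E)) (q : ℝ × E) : Set (ℝ × E) :=
  {p | q ∈ K ∧ ∃ σ : ℝ, 0 ≤ σ ∧ ∀ q' ∈ K,
    p.1 * (q'.1 - q.1) + ⟪p.2, q'.2 - q.2⟫ ≤ σ * ((q'.1 - q.1) ^ 2 + ‖q'.2 - q.2‖ ^ 2)}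

/-- Proximal normal cone in the product space `ℝ × E × ℝ`. -/
def proxNormalCone3 (K : Set (ℝ × E × ℝ)) (q : ℝ × E × ℝ) : Set (ℝ × E × ℝ) :=
  {p | q ∈ K ∧ ∃ σ : ℝ, 0 ≤ σ ∧ ∀ q' ∈ K,
    p.1 * (q'.1 - q.1) + ⟪p.2.1, q'.2.1 - q.2.1⟫ + p.2.2 * (q'.2.2 - q.2.2) ≤
      σ * ((q'.1 - q.1) ^ 2 + ‖q'.2.1 - q.2.1‖ ^ 2 + (q'.2.2 - q.2.2) ^ 2)}

/-- Proximal normal cone in the product space `E × ℝ`. -/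
def proxNormalConeER (K : Set (E × ℝ)) (q : E × ℝ) : Set (E × ℝ) :=
  {p | q ∈ K ∧ ∃ σ : ℝ, 0 ≤ σ ∧ ∀ q' ∈ K,
    ⟪p.1, q'.1 - q.1⟫ + p.2 * (q'.2 - q.2) ≤ σ * (‖q'.1 - q.1‖ ^ 2 + (q'.2 - q.2) ^ 2)}

/-- The graph of the moving set `C`, i.e. `{(t,x) : t ≥ 0, x ∈ C(t)}`. -/
def graphSet (C : ℝ → Set E) : Set (ℝ × E) := {q | 0 ≤ q.1 ∧ q.2 ∈ C q.1}


open Filter Topology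

theorem LipschitzWith.intervalIntegral_deriv_eq_sub [FiniteDimensional ℝ E] {K : NNReal}
    {f : ℝ → E} (hf : LipschitzWith K f) (a b : ℝ) :
    IntervalIntegrable (deriv f) volume a b ∧ ∫ s in a..b, deriv f s = f b - f a := by
  have hint : ∀ a b, IntervalIntegrable (deriv f) volume a b := fun a b =>
    (intervalIntegrable_const (c := (K : ℝ))).mono_fun (aestronglyMeasurable_deriv _ _)
      (ae_of_all _ fun t => by
        simpa using norm_deriv_le_of_lipschitz (x₀ := t) hf)
  refine ⟨hint a b, ?_⟩
  have hlip : LipschitzWith K fun t => ∫ s in a..t, deriv f s :=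
    LipschitzWith.of_dist_le_mul fun u v => by
      rw [dist_eq_norm, intervalIntegral.integral_interval_sub_left (hint _ _) (hint _ _),
        Real.dist_eq]
      exact intervalIntegral.norm_integral_le_of_norm_le_const fun s _ =>
        norm_deriv_le_of_lipschitz hf
  have hac : AbsolutelyContinuousOnInterval (fun t => f t - ∫ s in a..t, deriv f s) a b :=
    (hf.lipschitzOnWith (s := uIcc a b)).absolutelyContinuousOnInterval.sub
      (hlip.lipschitzOnWith (s := uIcc a b)).absolutelyContinuousOnInterval
  have hderiv : ∀ᵐ t, t ∈ uIcc a b →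
      HasDerivAt (fun t => f t - ∫ s in a..t, deriv f s) 0 t := by
    filter_upwards [hf.ae_differentiableAt_real, (hint a b).ae_hasDerivAt_integral] with t h1 h2 ht
    have h3 := HasDerivAt.fun_sub h1.hasDerivAt (h2 ht a left_mem_uIcc)
    rwa [sub_self] at h3
  obtain ⟨c, hc⟩ := hac.const_of_ae_hasDerivAt_zero hderiv
  have ha := hc a left_mem_uIcc
  have hb := hc b right_mem_uIcc
  simp only [intervalIntegral.integral_same, sub_zero] at ha hb
  rw [ha, ← hb]
  abel

/-- The velocities `-ζ + g` of the sweeping process whose normal part `ζ` is bounded by `K` and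
satisfies the proximal inequality with constant `σ`. -/
def boundedVelocity (C : ℝ → Set E) (G : ℝ → E → Set E) (σ K t : ℝ) (x : E) : Set E :=
  {v | ∃ ζ g : E, v = -ζ + g ∧ ‖ζ‖ ≤ K ∧ g ∈ G t x ∧ ∀ y ∈ C t, ⟪ζ, y - x⟫ ≤ σ * ‖y - x‖ ^ 2}

section Velocity

variable {C : ℝ → Set E} {G : ℝ → E → Set E} {r L_C M L_G σ K : ℝ}

theorem HypC.lipschitz_const_nonneg (hC : HypC r L_C C) : 0 ≤ L_C := by
  have h := hausdorffDist_nonneg.trans (hC.lipschitz 0 1 le_rfl zero_le_one)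
  simpa using h

theorem HypC.exists_dist_le (hC : HypC r L_C C) {s t : ℝ} (hs : 0 ≤ s) (ht : 0 ≤ t) {y : E}
    (hy : y ∈ C s) : ∃ z ∈ C t, dist y z ≤ L_C * |s - t| := by
  obtain ⟨z, hz, h⟩ := (hC.isCompact t ht).exists_infDist_eq_dist (hC.nonempty t ht) y
  refine ⟨z, hz, h ▸ (infDist_le_hausdorffDist_of_mem hy ?_).trans (hC.lipschitz s t hs ht)⟩
  exact hausdorffEDist_ne_top_of_nonempty_of_bounded (hC.nonempty s hs) (hC.nonempty t ht)
    (hC.isCompact s hs).isBounded (hC.isCompact t ht).isBounded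

theorem HypG.infDist_le (hG : HypG M L_G G) {s t : ℝ} {x y g : E} (hg : g ∈ G s x) :
    infDist g (G t y) ≤ L_G * (|s - t| + ‖x - y‖) := by
  have hb : ∀ t x, Bornology.IsBounded (G t x) := fun t x =>
    isBounded_iff_forall_norm_le.2 ⟨M, hG.bounded t x⟩
  exact (infDist_le_hausdorffDist_of_mem hg (hausdorffEDist_ne_top_of_nonempty_of_bounded
    (hG.nonempty s x) (hG.nonempty t y) (hb s x) (hb t y))).trans (hG.lipschitz s t x y)

theorem convex_boundedVelocity (hG : HypG M L_G G) (t : ℝ) (x : E) :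
    Convex ℝ (boundedVelocity C G σ K t x) := by
  rintro _ ⟨ζ, g, rfl, hζ, hg, hn⟩ _ ⟨ζ', g', rfl, hζ', hg', hn'⟩ a b ha hb hab
  refine ⟨a • ζ + b • ζ', a • g + b • g', by module, ?_, hG.convex t x hg hg' ha hb hab, ?_⟩
  · exact mem_closedBall_zero_iff.1 (convex_closedBall (0 : E) K (mem_closedBall_zero_iff.2 hζ)
      (mem_closedBall_zero_iff.2 hζ') ha hb hab)
  · intro y hy
    rw [inner_add_left, real_inner_smul_left, real_inner_smul_left]
    calc _ ≤ a * (σ * ‖y - x‖ ^ 2) + b * (σ * ‖y - x‖ ^ 2) := by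
          gcongr
          exacts [hn y hy, hn' y hy]
      _ = σ * ‖y - x‖ ^ 2 := by rw [← add_mul, hab, one_mul]

theorem norm_le_of_mem_boundedVelocity (hG : HypG M L_G G) {t : ℝ} {x v : E}
    (hv : v ∈ boundedVelocity C G σ K t x) : ‖v‖ ≤ K + M := by
  obtain ⟨ζ, g, rfl, hζ, hg, -⟩ := hv
  calc ‖-ζ + g‖ ≤ ‖-ζ‖ + ‖g‖ := norm_add_le _ _
    _ ≤ K + M := by rw [norm_neg]; exact add_le_add hζ (hG.bounded t x g hg)

theorem boundedVelocity_subset (hσ : 0 ≤ σ) {t : ℝ} {x : E} (hx : x ∈ C t) :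
    boundedVelocity C G σ K t x ⊆ -proxNormalCone (C t) x + G t x := by
  rintro _ ⟨ζ, g, rfl, -, hg, hn⟩
  exact Set.add_mem_add (by simpa using ⟨hx, σ, hσ, hn⟩) hg

theorem Ultrafilter.exists_tendsto_of_norm_le [FiniteDimensional ℝ E] {ι : Type*}
    (U : Ultrafilter ι) {f : ι → E} {R : ℝ} (hf : ∀ᶠ i in U, ‖f i‖ ≤ R) :
    ∃ z, Tendsto f U (𝓝 z) := by
  obtain ⟨z, -, hz⟩ := (isCompact_closedBall (0 : E) R).ultrafilter_le_nhds' (U.map f)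
    (hf.mono fun i hi => mem_closedBall_zero_iff.2 hi)
  exact ⟨z, hz⟩

theorem mem_boundedVelocity_of_tendsto [FiniteDimensional ℝ E] (hC : HypC r L_C C)
    (hG : HypG M L_G G) {ι : Type*} {l : Filter ι} [l.NeBot] {s : ι → ℝ} {y v : ι → E} {t : ℝ}
    {x w : E} (ht : 0 ≤ t) (hs₀ : ∀ᶠ i in l, 0 ≤ s i) (hs : Tendsto s l (𝓝 t))
    (hy : Tendsto y l (𝓝 x)) (hv : Tendsto v l (𝓝 w))
    (hmem : ∀ᶠ i in l, v i ∈ boundedVelocity C G σ K (s i) (y i)) :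
    w ∈ boundedVelocity C G σ K t x := by
  set U := Ultrafilter.of l
  have hU : (U : Filter ι) ≤ l := Ultrafilter.of_le l
  replace hs₀ : ∀ᶠ i in (U : Filter ι), 0 ≤ s i := hU hs₀
  replace hs := hs.mono_left hU
  replace hy := hy.mono_left hU
  replace hv := hv.mono_left hU
  replace hmem : ∀ᶠ i in (U : Filter ι), v i ∈ boundedVelocity C G σ K (s i) (y i) := hU hmem
  choose! ζ g hvζ hζ hg hn using fun i (h : v i ∈ boundedVelocity C G σ K (s i) (y i)) => h
  obtain ⟨ζ₀, hζ₀⟩ := U.exists_tendsto_of_norm_le (hmem.mono hζ)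
  obtain ⟨g₀, hg₀⟩ := U.exists_tendsto_of_norm_le (hmem.mono fun i hi => hG.bounded _ _ _ (hg i hi))
  refine ⟨ζ₀, g₀, ?_, le_of_tendsto hζ₀.norm (hmem.mono hζ), ?_, fun z hz => ?_⟩
  · exact tendsto_nhds_unique (hv.congr' (hmem.mono hvζ)) (hζ₀.neg.add hg₀)
  · rw [(hG.isClosed t x).mem_iff_infDist_zero (hG.nonempty t x)]
    refine le_antisymm ?_ infDist_nonneg
    have h1 : Tendsto (fun i => infDist (g i) (G t x)) U (𝓝 (infDist g₀ (G t x))) :=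
      (continuous_infDist_pt _).continuousAt.tendsto.comp hg₀
    have h2 : Tendsto (fun i => L_G * (|s i - t| + ‖y i - x‖)) U
        (𝓝 (L_G * (|t - t| + ‖x - x‖))) :=
      (((hs.sub_const t).abs).add (hy.sub_const x).norm).const_mul _
    have := le_of_tendsto_of_tendsto h1 h2 (hmem.mono fun i hi => hG.infDist_le (hg i hi))
    simpa using this
  · choose! p hp hpd using fun i (h : 0 ≤ s i) => hC.exists_dist_le ht h hz
    have hpz : Tendsto p U (𝓝 z) := by
      rw [tendsto_iff_dist_tendsto_zero]
      have h2 : Tendsto (fun i => L_C * |t - s i|) U (𝓝 0) := by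
        simpa using ((hs.const_sub t).abs).const_mul L_C
      exact squeeze_zero' (Eventually.of_forall fun _ => dist_nonneg)
        (hs₀.mono fun i hi => by rw [dist_comm]; exact hpd i hi) h2
    refine le_of_tendsto_of_tendsto (hζ₀.inner (hpz.sub hy))
      (((hpz.sub hy).norm.pow 2).const_mul σ) ?_
    filter_upwards [hmem, hs₀] with i hi hi'
    exact hn i hi _ (hp i hi')

theorem isClosed_boundedVelocity [FiniteDimensional ℝ E] (hC : HypC r L_C C) (hG : HypG M L_G G)
    {t : ℝ} (ht : 0 ≤ t) (x : E) : IsClosed (boundedVelocity C G σ K t x) := by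
  refine isClosed_iff_forall_filter.2 fun w l hl hle hw => ?_
  exact mem_boundedVelocity_of_tendsto hC hG ht (s := fun _ => t) (y := fun _ => x) (v := id)
    (Eventually.of_forall fun _ => ht) tendsto_const_nhds tendsto_const_nhds hw
    (le_principal_iff.1 hle)

theorem eventually_boundedVelocity_subset_cthickening [FiniteDimensional ℝ E]
    (hC : HypC r L_C C) (hG : HypG M L_G G) {t ε : ℝ} (ht : 0 ≤ t) (x : E) (hε : 0 < ε) :
    ∀ᶠ p in 𝓝 (t, x), 0 ≤ p.1 →
      boundedVelocity C G σ K p.1 p.2 ⊆ cthickening ε (boundedVelocity C G σ K t x) := by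
  by_contra h
  rw [not_eventually] at h
  simp only [Classical.not_imp, Set.not_subset] at h
  set l := 𝓝 (t, x) ⊓ 𝓟 {p : ℝ × E | 0 ≤ p.1 ∧ ∃ v ∈ boundedVelocity C G σ K p.1 p.2,
    v ∉ cthickening ε (boundedVelocity C G σ K t x)}
  have hne : l.NeBot := frequently_mem_iff_neBot.1 h
  set U := Ultrafilter.of l
  have hU : (U : Filter (ℝ × E)) ≤ l := Ultrafilter.of_le l
  have hU1 : (U : Filter (ℝ × E)) ≤ 𝓝 (t, x) := hU.trans inf_le_left
  have hU2 := le_principal_iff.1 (hU.trans inf_le_right)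
  choose! v hv hv' using fun p : ℝ × E => fun h : ∃ v ∈ boundedVelocity C G σ K p.1 p.2,
    v ∉ cthickening ε (boundedVelocity C G σ K t x) => h
  have hmem : ∀ᶠ p in (U : Filter (ℝ × E)), v p ∈ boundedVelocity C G σ K p.1 p.2 := by
    filter_upwards [hU2] with p hp using hv p hp.2
  obtain ⟨w, hw⟩ := U.exists_tendsto_of_norm_le
    (hmem.mono fun p hp => norm_le_of_mem_boundedVelocity hG hp)
  have hwF : w ∈ boundedVelocity C G σ K t x :=
    mem_boundedVelocity_of_tendsto hC hG ht (s := Prod.fst) (y := Prod.snd)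
      (by filter_upwards [hU2] with p hp using hp.1)
      ((continuous_fst.tendsto (t, x)).mono_left hU1)
      ((continuous_snd.tendsto (t, x)).mono_left hU1) hw hmem
  have hnear := hw.eventually
    (isOpen_thickening.mem_nhds (self_subset_thickening hε _ hwF))
  obtain ⟨p, hp1, hp2⟩ := (hnear.and hU2).exists
  exact hv' p hp2.2 (thickening_subset_cthickening _ _ hp1)

theorem norm_normal_le_of_hasDerivAt (hC : HypC r L_C C) {a t : ℝ} (ha : 0 ≤ a) (hat : a < t)
    {x : ℝ → E} (hx : ∀ s ∈ Icc a t, x s ∈ C s) {ζ g : E} (hζ : ζ ∈ proxNormalCone (C t) (x t))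
    (hd : HasDerivAt x (-ζ + g) t) : ‖ζ‖ ≤ L_C + ‖g‖ := by
  obtain ⟨-, σ, hσ, hn⟩ := hζ
  have hq := hd.tendsto_slope_zero_left
  set q : ℝ → E := fun h => h⁻¹ • (x (t + h) - x t) with hqdef
  have hL := hC.lipschitz_const_nonneg
  have hev : ∀ᶠ h in 𝓝[<] (0 : ℝ), -⟪ζ, q h⟫ ≤ ‖ζ‖ * L_C + σ * |h| * (‖q h‖ + L_C) ^ 2 := by
    filter_upwards [Ioo_mem_nhdsLT (show a - t < 0 by linarith)] with h hh
    have hh0 : h < 0 := hh.2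
    have hth : t + h ∈ Icc a t := ⟨by linarith [hh.1], by linarith⟩
    obtain ⟨y, hy, hyd⟩ := hC.exists_dist_le (t := t) (ha.trans hth.1) (by linarith) (hx _ hth)
    have habs : |t + h - t| = -h := by rw [add_sub_cancel_left, abs_of_neg hh0]
    rw [habs, dist_eq_norm] at hyd
    have hxq : x (t + h) - x t = h • q h := by
      rw [hqdef]; simp [smul_smul, mul_inv_cancel₀ hh0.ne]
    have h1 := hn y hy
    have hyx : y - x t = (h • q h) - (x (t + h) - y) := by rw [← hxq]; abel
    have h2 : ⟪ζ, y - x t⟫ = h * ⟪ζ, q h⟫ - ⟪ζ, x (t + h) - y⟫ := by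
      rw [hyx, inner_sub_right, real_inner_smul_right]
    have h3 : ⟪ζ, x (t + h) - y⟫ ≤ ‖ζ‖ * (L_C * -h) :=
      (real_inner_le_norm _ _).trans (by gcongr)
    have h4 : ‖y - x t‖ ≤ -h * (‖q h‖ + L_C) := by
      rw [hyx]
      refine (norm_sub_le _ _).trans ?_
      rw [norm_smul, Real.norm_eq_abs, abs_of_neg hh0]
      linarith
    have h5 : ‖y - x t‖ ^ 2 ≤ (-h * (‖q h‖ + L_C)) ^ 2 := by gcongr
    have h6 : -h * (-⟪ζ, q h⟫) ≤ -h * (‖ζ‖ * L_C + σ * |h| * (‖q h‖ + L_C) ^ 2) := by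
      rw [abs_of_neg hh0]
      nlinarith [mul_le_mul_of_nonneg_left h5 hσ]
    exact le_of_mul_le_mul_left h6 (by linarith)
  have hlim : Tendsto (fun h : ℝ => ‖ζ‖ * L_C + σ * |h| * (‖q h‖ + L_C) ^ 2) (𝓝[<] (0 : ℝ))
      (𝓝 (‖ζ‖ * L_C + σ * |0| * (‖-ζ + g‖ + L_C) ^ 2)) := by
    have h0 : Tendsto (fun h : ℝ => h) (𝓝[<] (0 : ℝ)) (𝓝 0) := nhdsWithin_le_nhds
    exact ((h0.abs.const_mul σ).mul ((hq.norm.add_const L_C).pow 2)).const_add _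
  have hle := le_of_tendsto_of_tendsto (tendsto_const_nhds.inner hq).neg hlim hev
  simp only [abs_zero, mul_zero, zero_mul, add_zero, inner_add_right, inner_neg_right,
    real_inner_self_eq_norm_sq] at hle
  have hcs := real_inner_le_norm ζ g
  by_contra! hcon
  have hpos : 0 < ‖ζ‖ := lt_of_le_of_lt (by positivity) hcon
  nlinarith

end Velocity

section Solution

variable {C : ℝ → Set E} {G : ℝ → E → Set E} {r L_C M L_G a b : ℝ} {x : ℝ → E}

theorem IsSweepingSol.mono {a' b' : ℝ} (h : IsSweepingSol C G a b x) (ha : a ≤ a')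
    (hb : b' ≤ b) : IsSweepingSol C G a' b' x := by
  obtain ⟨hxC, x', hint, hx, hae⟩ := h
  have hsub : Icc a' b' ⊆ Icc a b := Icc_subset_Icc ha hb
  refine ⟨fun t ht => hxC t (hsub ht), x', hint.mono_set hsub, fun t ht => ?_,
    ae_mono (Measure.restrict_mono hsub le_rfl) hae⟩
  have ha' : a' ∈ Icc a b := ⟨ha, (ht.1.trans ht.2).trans hb⟩
  have hi : ∀ u v, u ∈ Icc a b → v ∈ Icc a b → IntervalIntegrable x' volume u v :=
    fun u v hu hv => (hint.mono_set (uIcc_subset_Icc hu hv)).intervalIntegrable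
  have haa : a ∈ Icc a b := ⟨le_rfl, ha'.1.trans ha'.2⟩
  rw [hx t (hsub ht), hx a' ha', add_assoc,
    intervalIntegral.integral_add_adjacent_intervals (hi _ _ haa ha') (hi _ _ ha' (hsub ht))]

theorem IsSweepingSol.exists_boundedVelocity [FiniteDimensional ℝ E] (hr : 0 < r)
    (hC : HypC r L_C C) (hG : HypG M L_G G) (ha : 0 ≤ a) (h : IsSweepingSol C G a b x) :
    ∃ x' : ℝ → E, IntegrableOn x' (Icc a b) ∧
      (∀ s ∈ Icc a b, ∀ t ∈ Icc a b, x t - x s = ∫ u in s..t, x' u) ∧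
      ∀ᵐ t ∂(volume.restrict (Icc a b)),
        x' t ∈ boundedVelocity C G (1 / (2 * r) * (L_C + M)) (L_C + M) t (x t) := by
  obtain ⟨hxC, x', hint, hx, hae⟩ := h
  have hi : ∀ u v, u ∈ Icc a b → v ∈ Icc a b → IntervalIntegrable x' volume u v :=
    fun u v hu hv => (hint.mono_set (uIcc_subset_Icc hu hv)).intervalIntegrable
  refine ⟨x', hint, fun s hs t ht => ?_, ?_⟩
  · have haa : a ∈ Icc a b := ⟨le_rfl, hs.1.trans hs.2⟩
    rw [hx t ht, hx s hs, add_sub_add_left_eq_sub,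
      intervalIntegral.integral_interval_sub_left (hi _ _ haa ht) (hi _ _ haa hs)]
  rcases lt_or_ge b a with hab | hab
  · simp [Icc_eq_empty hab.not_ge]
  have haa : a ∈ Icc a b := ⟨le_rfl, hab⟩
  rw [← restrict_Ioo_eq_restrict_Icc] at hae ⊢
  rw [ae_restrict_iff' measurableSet_Ioo] at hae ⊢
  filter_upwards [hae, (hi a b haa ⟨hab, le_rfl⟩).ae_hasDerivAt_integral] with t ht hdt htI
  have htI' : t ∈ Icc a b := Ioo_subset_Icc_self htI
  obtain ⟨η, hη, g, hg, hηg⟩ := ht htI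
  have hd : HasDerivAt x (x' t) t := by
    rw [uIcc_of_le hab] at hdt
    refine ((hdt htI' a haa).const_add (x a)).congr_of_eventuallyEq ?_
    filter_upwards [Icc_mem_nhds htI.1 htI.2] with s hs using hx s hs
  have hζ : -η ∈ proxNormalCone (C t) (x t) := hη
  have hv : x' t = - -η + g := by rw [neg_neg]; exact hηg.symm
  rw [hv] at hd ⊢
  have hbd : ‖-η‖ ≤ L_C + M :=
    (norm_normal_le_of_hasDerivAt hC ha htI.1
      (fun s hs => hxC s ⟨hs.1, hs.2.trans htI.2.le⟩) hζ hd).trans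
      (by gcongr; exact hG.bounded _ _ _ hg)
  refine ⟨-η, g, rfl, hbd, hg, fun y hy => ?_⟩
  refine (hC.proxRegular t (ha.trans htI'.1) _ (hxC t htI') y hy _ hζ).trans ?_
  gcongr

theorem norm_sub_le_of_ae_boundedVelocity {σ K : ℝ} (hG : HypG M L_G G) {x' : ℝ → E}
    (hx : ∀ s ∈ Icc a b, ∀ t ∈ Icc a b, x t - x s = ∫ u in s..t, x' u)
    (hae : ∀ᵐ t ∂(volume.restrict (Icc a b)), x' t ∈ boundedVelocity C G σ K t (x t))
    {s t : ℝ} (hs : s ∈ Icc a b) (ht : t ∈ Icc a b) : ‖x t - x s‖ ≤ (K + M) * |t - s| := by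
  rw [hx s hs t ht]
  refine intervalIntegral.norm_integral_le_of_norm_le_const_ae ?_
  rw [ae_restrict_iff' measurableSet_Icc] at hae
  filter_upwards [hae] with u hu hu'
  exact norm_le_of_mem_boundedVelocity hG
    (hu (uIcc_subset_Icc hs ht (uIoc_subset_uIcc hu')))

theorem IsSweepingSol.norm_sub_le [FiniteDimensional ℝ E] (hr : 0 < r)
    (hC : HypC r L_C C) (hG : HypG M L_G G) (ha : 0 ≤ a) (h : IsSweepingSol C G a b x)
    {s t : ℝ} (hs : s ∈ Icc a b) (ht : t ∈ Icc a b) :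
    ‖x t - x s‖ ≤ (L_C + M + M) * |t - s| := by
  obtain ⟨x', -, hx, hae⟩ := h.exists_boundedVelocity hr hC hG ha
  exact norm_sub_le_of_ae_boundedVelocity hG hx hae hs ht

/-- The slope on `[t, t + h]` of a sweeping solution lies in every closed convex set containing
all admissible velocities near the starting point. -/
theorem IsSweepingSol.slope_mem [FiniteDimensional ℝ E] (hr : 0 < r)
    (hC : HypC r L_C C) (hG : HypG M L_G G) (ha : 0 ≤ a) (hsol : IsSweepingSol C G a b x)
    {t h δ : ℝ} {y : E} {A : Set E} (hA : Convex ℝ A) (hA' : IsClosed A)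
    (hsub : ∀ s z, |s - t| < δ → ‖z - y‖ < δ → 0 ≤ s →
      boundedVelocity C G (1 / (2 * r) * (L_C + M)) (L_C + M) s z ⊆ A)
    (hat : a ≤ t) (hh : 0 < h) (hb : t + h ≤ b) (hhδ : h < δ)
    (hclose : ‖x t - y‖ + (L_C + M + M) * h < δ) : h⁻¹ • (x (t + h) - x t) ∈ A := by
  obtain ⟨x', hint, hx, hae⟩ := hsol.exists_boundedVelocity hr hC hG ha
  have ht : t ∈ Icc a b := ⟨hat, by linarith⟩
  have hth : t + h ∈ Icc a b := ⟨by linarith, hb⟩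
  have hsubI : Ioc t (t + h) ⊆ Icc a b := Ioc_subset_Icc_self.trans (Icc_subset_Icc ht.1 hb)
  have hav := hA.set_average_mem (μ := volume) (t := Ioc t (t + h)) (f := x') hA'
    (by simp [hh]) (by simp) ?_ (hint.mono_set hsubI)
  · rw [setAverage_eq, ← intervalIntegral.integral_of_le (by linarith), ← hx t ht _ hth] at hav
    simpa [Measure.real, hh.le] using hav
  have hM : 0 ≤ L_C + M + M := by
    have := hC.lipschitz_const_nonneg
    obtain ⟨g, hg⟩ := hG.nonempty 0 0
    have := (norm_nonneg g).trans (hG.bounded 0 0 g hg)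
    linarith
  rw [ae_restrict_iff' measurableSet_Ioc]
  filter_upwards [(ae_restrict_iff' measurableSet_Icc).1 hae] with s hs hsI
  have habs : |s - t| = s - t := abs_of_pos (by linarith [hsI.1])
  refine hsub s (x s) ?_ ?_ (ha.trans (hsubI hsI).1) (hs (hsubI hsI))
  · rw [habs]; linarith [hsI.2]
  · calc ‖x s - y‖ = ‖(x t - y) + (x s - x t)‖ := by congr 1; abel
      _ ≤ ‖x t - y‖ + (L_C + M + M) * |s - t| := (norm_add_le _ _).trans (by
          gcongr; exact norm_sub_le_of_ae_boundedVelocity hG hx hae ht (hsubI hsI))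
      _ ≤ ‖x t - y‖ + (L_C + M + M) * h := by
          rw [habs]; gcongr; linarith [hsI.2]
      _ < δ := hclose

/-- Pointwise ultrafilter limits of sweeping solutions with a common initial point exist and are
sweeping solutions. -/
theorem IsSweepingSol.exists_ultrafilter_limit [FiniteDimensional ℝ E] (hr : 0 < r)
    (hC : HypC r L_C C) (hG : HypG M L_G G) (ha : 0 ≤ a) (hab : a ≤ b) {ι : Type*}
    (U : Ultrafilter ι) {X : ι → ℝ → E} {x₀ : E} (hX : ∀ i, IsSweepingSol C G a b (X i))
    (hX₀ : ∀ i, X i a = x₀) :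
    ∃ x : ℝ → E, IsSweepingSol C G a b x ∧
      ∀ t ∈ Icc a b, Tendsto (fun i => X i t) U (𝓝 (x t)) := by
  have hM : 0 ≤ M := by
    obtain ⟨g, hg⟩ := hG.nonempty 0 0
    exact (norm_nonneg g).trans (hG.bounded 0 0 g hg)
  have hL := hC.lipschitz_const_nonneg
  set K' := L_C + M + M
  have hK'0 : 0 ≤ K' := by positivity
  have haI : a ∈ Icc a b := left_mem_Icc.2 hab
  have hlip : ∀ i, ∀ s ∈ Icc a b, ∀ t ∈ Icc a b, ‖X i t - X i s‖ ≤ K' * |t - s| :=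
    fun i s hs t ht => (hX i).norm_sub_le hr hC hG ha hs ht
  have hex : ∀ t, ∃ z, Tendsto (fun i => X i (projIcc a b hab t)) U (𝓝 z) := fun t => by
    refine U.exists_tendsto_of_norm_le (R := ‖x₀‖ + K' * |projIcc a b hab t - a|)
      (Eventually.of_forall fun i => ?_)
    have h1 := hlip i a haI _ (projIcc a b hab t).2
    rw [hX₀] at h1
    have h2 := norm_add_le x₀ (X i (projIcc a b hab t) - x₀)
    rw [add_sub_cancel] at h2
    linarith
  choose x hx using hex
  have hxI : ∀ t ∈ Icc a b, Tendsto (fun i => X i t) U (𝓝 (x t)) := fun t ht => by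
    simpa [projIcc_of_mem hab ht] using hx t
  have hxlip : LipschitzWith K'.toNNReal x := by
    refine LipschitzWith.of_dist_le_mul fun s t => ?_
    rw [dist_eq_norm, Real.dist_eq, Real.coe_toNNReal _ hK'0]
    refine le_of_tendsto ((hx s).sub (hx t)).norm (Eventually.of_forall fun i => ?_)
    refine (hlip i _ (projIcc a b hab t).2 _ (projIcc a b hab s).2).trans ?_
    exact mul_le_mul_of_nonneg_left (abs_projIcc_sub_projIcc hab) hK'0
  have hxC : ∀ t ∈ Icc a b, x t ∈ C t := fun t ht =>
    (hC.isCompact t (ha.trans ht.1)).isClosed.mem_of_tendsto (hxI t ht)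
      (Eventually.of_forall fun i => (hX i).1 t ht)
  refine ⟨x, ⟨hxC, deriv x, ?_, fun t _ => ?_, ?_⟩, hxI⟩
  · exact (intervalIntegrable_iff_integrableOn_Icc_of_le hab).1
      (hxlip.intervalIntegral_deriv_eq_sub a b).1
  · rw [(hxlip.intervalIntegral_deriv_eq_sub a t).2, add_sub_cancel]
  rw [← restrict_Ioo_eq_restrict_Icc, ae_restrict_iff' measurableSet_Ioo]
  filter_upwards [hxlip.ae_differentiableAt_real] with t hd ht
  have ht0 : 0 ≤ t := ha.trans ht.1.le
  have htI : t ∈ Icc a b := Ioo_subset_Icc_self ht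
  apply boundedVelocity_subset (σ := 1 / (2 * r) * (L_C + M)) (K := L_C + M) (by positivity)
    (hxC t htI)
  have hcl := isClosed_boundedVelocity (σ := 1 / (2 * r) * (L_C + M)) (K := L_C + M)
    hC hG ht0 (x t)
  rw [← hcl.closure_eq, closure_eq_iInter_cthickening, mem_iInter₂]
  intro ε hε
  obtain ⟨δ, hδ, hball⟩ := Metric.eventually_nhds_iff.1
    (eventually_boundedVelocity_subset_cthickening (σ := 1 / (2 * r) * (L_C + M))
      (K := L_C + M) hC hG ht0 (x t) hε)
  refine isClosed_cthickening.mem_of_tendsto hd.hasDerivAt.tendsto_slope_zero_right ?_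
  have hη : 0 < min (min (b - t) δ) (δ / 2 / (K' + 1)) := by
    have := sub_pos.2 ht.2
    positivity
  filter_upwards [Ioo_mem_nhdsGT hη] with h hh
  have hh0 := hh.1
  have hh1 : h < b - t := hh.2.trans_le ((min_le_left _ _).trans (min_le_left _ _))
  have hh2 : h < δ := hh.2.trans_le ((min_le_left _ _).trans (min_le_right _ _))
  have hh3 : h < δ / 2 / (K' + 1) := hh.2.trans_le (min_le_right _ _)
  rw [lt_div_iff₀ (by positivity)] at hh3
  have hthI : t + h ∈ Icc a b := ⟨by linarith [htI.1], by linarith⟩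
  refine isClosed_cthickening.mem_of_tendsto
    (((hxI _ hthI).sub (hxI t htI)).const_smul h⁻¹) ?_
  have hnear := (tendsto_iff_norm_sub_tendsto_zero.1 (hxI t htI)).eventually
    (gt_mem_nhds (half_pos hδ))
  filter_upwards [hnear] with i hi
  refine (hX i).slope_mem hr hC hG ha ((convex_boundedVelocity hG t (x t)).cthickening ε)
    isClosed_cthickening (fun s z hs hz hs0 => ?_) htI.1 hh0 hthI.2 hh2 (y := x t) ?_
  · refine hball (y := (s, z)) ?_ hs0
    rw [Prod.dist_eq, max_lt_iff, Real.dist_eq, dist_eq_norm]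
    exact ⟨hs, hz⟩
  · linarith

theorem minTime_le {S : Set E} {t₀ T s : ℝ} (h : IsSweepingSol C G t₀ T x) (hS : x T ∈ S)
    (hts : t₀ ≤ s) (hsT : s ≤ T) : minTime C G S s (x s) ≤ ENNReal.ofReal (T - s) := by
  refine sInf_le ⟨T - s, ⟨by linarith, x, ?_, rfl, ?_⟩, rfl⟩
  · rw [add_sub_cancel]; exact h.mono hts le_rfl
  · rwa [add_sub_cancel]

theorem exists_isSweepingSol_of_minTime_ne_top {S : Set E} {t₀ : ℝ} {x₀ : E}
    (h : minTime C G S t₀ x₀ ≠ ⊤) {ε : ℝ} (hε : 0 < ε) :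
    ∃ τ, (minTime C G S t₀ x₀).toReal ≤ τ ∧ τ < (minTime C G S t₀ x₀).toReal + ε ∧
      ∃ x : ℝ → E, IsSweepingSol C G t₀ (t₀ + τ) x ∧ x t₀ = x₀ ∧ x (t₀ + τ) ∈ S := by
  have hlt : minTime C G S t₀ x₀ < ENNReal.ofReal ((minTime C G S t₀ x₀).toReal + ε) := by
    rw [ENNReal.lt_ofReal_iff_toReal_lt h]; linarith
  obtain ⟨_, ⟨τ, ⟨hτ, hx⟩, rfl⟩, hτ'⟩ := sInf_lt_iff.1 hlt
  refine ⟨τ, ENNReal.toReal_le_of_le_ofReal hτ (sInf_le ⟨τ, ⟨hτ, hx⟩, rfl⟩), ?_, hx⟩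
  exact lt_of_not_ge fun hge => hτ'.not_ge (ENNReal.ofReal_le_ofReal hge)

end Solution

/-- if the minimum time function `T` is lower semicontinuous on the graph of `C`
and not identically `+∞`, then its epigraph is weakly invariant for the augmented dynamics:
from any `(t₀,x₀)` with `T(t₀,x₀) < ∞` and any `λ₀ ≥ T(t₀,x₀)` there is a solution along
which `T(t₀+s, x(t₀+s)) ≤ λ₀ − s`. -/
theorem epigraph_weak_invariance {n : ℕ} (r L_C M L_G : ℝ) (hr : 0 < r)
    (C : ℝ → Set (EuclideanSpace ℝ (Fin n)))
    (G : ℝ → EuclideanSpace ℝ (Fin n) → Set (EuclideanSpace ℝ (Fin n)))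
    (hC : HypC r L_C C) (hG : HypG M L_G G)
    (S : Set (EuclideanSpace ℝ (Fin n))) (hS : IsClosed S)
    (hlsc : LowerSemicontinuousOn
      (fun q : ℝ × EuclideanSpace ℝ (Fin n) => minTime C G S q.1 q.2) (graphSet C))
    (hnotinfty : ∃ t x, 0 ≤ t ∧ x ∈ C t ∧ minTime C G S t x ≠ ⊤) :
    ∀ t₀ x₀, 0 ≤ t₀ → x₀ ∈ C t₀ → minTime C G S t₀ x₀ ≠ ⊤ →
      ∀ l₀ : ℝ, minTime C G S t₀ x₀ ≤ ENNReal.ofReal l₀ →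
        ∃ x : ℝ → EuclideanSpace ℝ (Fin n),
          IsSweepingSol C G t₀ (t₀ + (minTime C G S t₀ x₀).toReal) x ∧ x t₀ = x₀ ∧
          ∀ s ∈ Icc (0 : ℝ) (minTime C G S t₀ x₀).toReal,
            minTime C G S (t₀ + s) (x (t₀ + s)) ≤ ENNReal.ofReal (l₀ - s) := by
  intro t₀ x₀ ht₀ hx₀ hfin l₀ hl₀
  set T := (minTime C G S t₀ x₀).toReal with hT
  have hT0 : 0 ≤ T := ENNReal.toReal_nonneg
  choose τ hTτ hτT X hX hX₀ hXS using fun k : ℕ =>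
    exists_isSweepingSol_of_minTime_ne_top hfin (ε := 1 / ((k : ℝ) + 1)) (by positivity)
  have hτ : Tendsto τ (hyperfilter ℕ) (𝓝 T) := by
    have h1 : Tendsto (fun k : ℕ => T + 1 / ((k : ℝ) + 1)) atTop (𝓝 T) := by
      simpa using (tendsto_one_div_add_atTop_nhds_zero_nat (𝕜 := ℝ)).const_add T
    exact (tendsto_of_tendsto_of_tendsto_of_le_of_le tendsto_const_nhds h1 hTτ
      fun k => (hτT k).le).mono_left Nat.hyperfilter_le_atTop
  have hX' : ∀ k, IsSweepingSol C G t₀ (t₀ + T) (X k) := fun k =>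
    (hX k).mono le_rfl (by linarith [hTτ k])
  obtain ⟨x, hx, hlim⟩ := IsSweepingSol.exists_ultrafilter_limit hr hC hG ht₀
    (by linarith) (hyperfilter ℕ) hX' hX₀
  refine ⟨x, hx, ?_, fun s hs => ?_⟩
  · have h1 := hlim t₀ ⟨le_rfl, by linarith⟩
    simp only [hX₀] at h1
    exact tendsto_nhds_unique h1 tendsto_const_nhds
  have hsI : t₀ + s ∈ Icc t₀ (t₀ + T) := ⟨by linarith [hs.1], by linarith [hs.2]⟩
  have hs0 : 0 ≤ t₀ + s := ht₀.trans hsI.1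
  have hle : minTime C G S (t₀ + s) (x (t₀ + s)) ≤ ENNReal.ofReal (T - s) := by
    refine le_of_forall_lt_imp_le_of_dense fun c hc => ?_
    have hev := hlsc (t₀ + s, x (t₀ + s)) ⟨hs0, hx.1 _ hsI⟩ c hc
    have hpair : Tendsto (fun k => (t₀ + s, X k (t₀ + s))) (hyperfilter ℕ)
        (𝓝[graphSet C] (t₀ + s, x (t₀ + s))) :=
      tendsto_nhdsWithin_iff.2 ⟨tendsto_const_nhds.prodMk_nhds (hlim _ hsI),
        Eventually.of_forall fun k => ⟨hs0, (hX' k).1 _ hsI⟩⟩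
    refine ge_of_tendsto (ENNReal.tendsto_ofReal (hτ.sub_const s)) ?_
    filter_upwards [hpair.eventually hev] with k hk
    refine (le_of_lt hk).trans ((minTime_le (hX k) (hXS k) hsI.1
      (by linarith [hs.2, hTτ k])).trans_eq ?_)
    rw [add_sub_add_left_eq_sub]
  refine hle.trans ?_
  rcases le_or_gt 0 l₀ with hl | hl
  · exact ENNReal.ofReal_le_ofReal (by linarith [ENNReal.toReal_le_of_le_ofReal hl hl₀])
  · have hT' : T = 0 := by
      rw [hT, nonpos_iff_eq_zero.1 (hl₀.trans_eq (ENNReal.ofReal_of_nonpos hl.le)),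
        ENNReal.toReal_zero]
    rw [ENNReal.ofReal_of_nonpos (by linarith [hs.1])]
    exact zero_le
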